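/- arXiv:2311.00601 — 7 statements merged into one kernel-verified Lean document; each statement's English description precedes it below -/
import Mathlib

section
/- Let R be a commutative local ring with maximal ideal m which is coherent (every finitely generated ideal of R is finitely presented as an R-module) and self-ℵ₀-injective (Ext¹_R(R/I, R) = 0 for every finitely generated ideal I; equivalently, every R-linear map I → R from a finitely generated ideal I extends to an R-linear endomorphism of R). Then R is separated (⋂_{n>0} m^n = 0) if and only if R is purely separated (the canonical map R → R̂ = lim_n R/m^n is a pure monomorphism of R-modules). -/
open IsLocalRing

open scoped TensorProduct

/-- Over a coherent self-`ℵ₀`-injective ring, a functional on a finite module vanishing on the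
common kernel of finitely many functionals is a linear combination of them. -/
theorem exists_sum_smul_eq_of_coherent_of_selfInjective {R : Type*} [CommRing R]
    (hcoh : ∀ I : Ideal R, I.FG → Module.FinitePresentation R I)
    (hinj : ∀ I : Ideal R, I.FG → ∀ f : I →ₗ[R] R, ∃ g : R →ₗ[R] R, ∀ x : I, g (x : R) = f x)
    {k : ℕ} {P : Type*} [AddCommGroup P] [Module R P] [Module.Finite R P]
    (φ : Fin k → P →ₗ[R] R) (f : P →ₗ[R] R) (h : ∀ p, (∀ i, φ i p = 0) → f p = 0) :
    ∃ r : Fin k → R, ∀ p, f p = ∑ i, r i * φ i p := by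
  induction k generalizing P with
  | zero => exact ⟨0, fun p => by simpa using h p (by simp)⟩
  | succ k ih =>
    have hI : (LinearMap.range (φ 0)).FG := by
      rw [LinearMap.range_eq_map]
      exact (Module.Finite.fg_top (R := R) (M := P)).map (φ 0)
    have := hcoh _ hI
    have hK : (LinearMap.ker (φ 0)).FG := by
      rw [← LinearMap.ker_rangeRestrict]
      exact Module.FinitePresentation.fg_ker _ (φ 0).surjective_rangeRestrict
    have : Module.Finite R (LinearMap.ker (φ 0)) := Module.Finite.iff_fg.mpr hK
    obtain ⟨r, hr⟩ := ih (fun i => φ i.succ ∘ₗ (LinearMap.ker (φ 0)).subtype)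
      (f ∘ₗ (LinearMap.ker (φ 0)).subtype)
      (fun p hp => h p (Fin.cases p.2 hp))
    let d : P →ₗ[R] R := f - ∑ i, r i • φ i.succ
    have hd : LinearMap.ker (φ 0) ≤ LinearMap.ker d := fun p hp => by
      have := hr ⟨p, hp⟩
      simp only [LinearMap.comp_apply, Submodule.subtype_apply] at this
      simp [d, this]
    obtain ⟨g, hg⟩ := hinj _ hI
      ((LinearMap.ker (φ 0)).liftQ d hd ∘ₗ (φ 0).quotKerEquivRange.symm.toLinearMap)
    have hgd (p : P) : g (φ 0 p) = d p := by
      have := hg ⟨φ 0 p, p, rfl⟩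
      simpa [LinearMap.quotKerEquivRange_symm_apply_image (φ 0) p ⟨p, rfl⟩] using this
    refine ⟨Fin.cons (g 1) r, fun p => ?_⟩
    have h1 : g (φ 0 p) = g 1 * φ 0 p := by
      rw [mul_comm, ← smul_eq_mul, ← map_smul, smul_eq_mul, mul_one]
    have h2 := hgd p
    simp only [h1, d, LinearMap.sub_apply, LinearMap.sum_apply, LinearMap.smul_apply,
      smul_eq_mul] at h2
    simp [Fin.sum_univ_succ, h2]

/-- Over a coherent self-`ℵ₀`-injective ring, every injective linear map out of the ring is pure. -/
theorem rTensor_injective_of_coherent_of_selfInjective {R : Type*} [CommRing R]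
    (hcoh : ∀ I : Ideal R, I.FG → Module.FinitePresentation R I)
    (hinj : ∀ I : Ideal R, I.FG → ∀ f : I →ₗ[R] R, ∃ g : R →ₗ[R] R, ∀ x : I, g (x : R) = f x)
    {S : Type*} [AddCommGroup S] [Module R S] (j : R →ₗ[R] S) (hj : Function.Injective j)
    (M : Type*) [AddCommGroup M] [Module R M] :
    Function.Injective (j.rTensor M) := by
  refine (injective_iff_map_eq_zero _).mpr fun t ht => ?_
  obtain ⟨m, rfl⟩ := (TensorProduct.lid R M).symm.surjective t
  suffices m = 0 by simp [this]
  let P : Submodule R S := R ∙ j 1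
  let s : P := ⟨j 1, Submodule.mem_span_singleton_self _⟩
  obtain ⟨Q, hPQ, hQ, hs⟩ := TensorProduct.eq_zero_of_fg_of_subtype_eq_zero
    (P := P) (t := s ⊗ₜ[R] m) (Submodule.fg_span_singleton _) (by simpa [s] using ht)
  have : Module.Finite R Q := Module.Finite.iff_fg.mpr hQ
  obtain ⟨k, x, hx⟩ := Module.Finite.exists_fin (R := R) (M := Q)
  have hspan : Submodule.span R
      (Set.range (Fin.cons (Submodule.inclusion hPQ s) x : Fin (k + 1) → Q)) = ⊤ := by
    rw [eq_top_iff, ← hx, Fin.range_cons]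
    exact Submodule.span_mono (Set.subset_insert _ _)
  obtain ⟨l, a, y, hy, ha⟩ := TensorProduct.vanishesTrivially_of_sum_tmul_eq_zero R hspan
    (n := (Fin.cons m 0 : Fin (k + 1) → M)) (by simpa [Fin.sum_univ_succ] using hs)
  -- The system `∑ i, a i.succ j * r i = a 0 j` has the solution `r = -x` in `Q`; solve it in `R`.
  obtain ⟨r, hr⟩ := exists_sum_smul_eq_of_coherent_of_selfInjective hcoh hinj
    (fun i => Fintype.linearCombination R (a (Fin.succ i))) (Fintype.linearCombination R (a 0))
    (fun c hc => by
      simp only [Fintype.linearCombination_apply, smul_eq_mul] at hc ⊢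
      refine (injective_iff_map_eq_zero j).mp hj _ ?_
      have key : ∑ q, c q • ∑ i, a i q •
          (Fin.cons (Submodule.inclusion hPQ s) x : Fin (k + 1) → Q) i = 0 := by simp [ha]
      simp only [Finset.smul_sum, smul_smul] at key
      rw [Finset.sum_comm] at key
      simp only [← Finset.sum_smul, Fin.sum_univ_succ, Fin.cons_zero, Fin.cons_succ, hc,
        zero_smul, Finset.sum_const_zero, add_zero] at key
      rw [← mul_one (∑ q, _), ← smul_eq_mul, map_smul]
      exact congrArg Subtype.val key)
  have hr' (q : Fin l) : a 0 q = ∑ i, r i * a (Fin.succ i) q := by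
    simpa [Fintype.linearCombination_apply_single] using hr (Pi.single q 1)
  have h0 := hy 0
  simp only [Fin.cons_zero, hr', Finset.sum_smul] at h0
  rw [h0, Finset.sum_comm]
  refine Finset.sum_eq_zero fun i _ => ?_
  have hi := hy i.succ
  simp only [Fin.cons_succ, Pi.zero_apply] at hi
  simp only [mul_smul, ← Finset.smul_sum, ← hi, smul_zero]

/-- Let `R` be a commutative local ring with maximal ideal `m` which is coherent (every
finitely generated ideal of `R` is finitely presented as an `R`-module) and
self-`ℵ₀`-injective (every `R`-linear map `I → R` from a finitely generated ideal `I`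
extends to an `R`-linear endomorphism of `R`). Then `R` is separated (`⋂_{n>0} mⁿ = 0`)
if and only if `R` is purely separated (the canonical map `R → R̂ = lim_n R/mⁿ` is a pure
monomorphism of `R`-modules). -/
theorem stmt_3 {R : Type u} [CommRing R] [IsLocalRing R]
    (hcoh : ∀ I : Ideal R, I.FG → Module.FinitePresentation R I)
    (hinj : ∀ I : Ideal R, I.FG → ∀ f : I →ₗ[R] R,
        ∃ g : R →ₗ[R] R, ∀ x : I, g (x : R) = f x) :
    (⨅ n : ℕ, (maximalIdeal R) ^ (n + 1)) = ⊥ ↔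
    (∀ (M : Type u) [AddCommGroup M] [Module R M],
        Function.Injective
          (LinearMap.rTensor M (AdicCompletion.of (maximalIdeal R) R))) := by
  constructor
  · intro h M _ _
    refine rTensor_injective_of_coherent_of_selfInjective hcoh hinj _
      (AdicCompletion.of_injective_iff.mpr ⟨fun x hx => ?_⟩) M
    rw [← Submodule.mem_bot R, ← h, Submodule.mem_iInf]
    exact fun n => by simpa [SModEq.zero] using hx (n + 1)
  · intro h
    have hof : Function.Injective (AdicCompletion.of (maximalIdeal R) R) := by
      refine (injective_iff_map_eq_zero _).mpr fun x hx => ?_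
      have := (injective_iff_map_eq_zero _).mp (h R) (x ⊗ₜ[R] 1) (by simp [hx])
      simpa using congrArg (TensorProduct.rid R R) this
    refine eq_bot_iff.mpr fun x hx => ?_
    refine (AdicCompletion.of_injective_iff.mp hof).haus x fun n => ?_
    rw [SModEq.zero, smul_eq_mul, Ideal.mul_top]
    exact Ideal.pow_le_pow_right n.le_succ ((Submodule.mem_iInf _).mp hx n)
end

section
/- Let (R_i)_{i ∈ I} be a directed system of commutative rings with directed colimit R = colim_{i ∈ I} R_i, such that every transition map R_i → R_j (i ≤ j) is flat and each R_i is coherent (every finitely generated ideal of R_i is finitely presented) and self-ℵ₀-injective (every R_i-linear map from a finitely generated ideal of R_i to R_i extends to R_i). Then R is self-ℵ₀-injective: every R-linear map from a finitely generated ideal of R to R extends to an R-linear endomorphism of R. -/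
/-- If every linear map from a finitely generated ideal of `S` to `S` extends to `S`, then a finite
system of equations `c * a k = b k` has a solution as soon as `b` satisfies every linear relation
satisfied by `a`. -/
theorem exists_mul_eq_of_relations {S κ : Type*} [CommRing S] [Fintype κ]
    (hinj : ∀ I : Ideal S, I.FG → ∀ φ : I →ₗ[S] S, ∃ g : S →ₗ[S] S, ∀ x : I, g (x : S) = φ x)
    (a b : κ → S) (hab : ∀ r : κ → S, ∑ k, r k * a k = 0 → ∑ k, r k * b k = 0) :
    ∃ c : S, ∀ k, c * a k = b k := by
  classical
  let L := Fintype.linearCombination S a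
  have hker : LinearMap.ker L ≤ LinearMap.ker (Fintype.linearCombination S b) := fun r hr ↦ by
    simpa [Fintype.linearCombination_apply] using
      hab r (by simpa [L, Fintype.linearCombination_apply] using hr)
  obtain ⟨g, hg⟩ := hinj (LinearMap.range L)
    (by rw [← Submodule.map_top]; exact Module.Finite.fg_top.map L)
    ((LinearMap.ker L).liftQ _ hker ∘ₗ L.quotKerEquivRange.symm.toLinearMap)
  refine ⟨g 1, fun k ↦ ?_⟩
  have h := hg (L.quotKerEquivRange (Submodule.Quotient.mk (Pi.single k 1)))
  rw [LinearMap.comp_apply, LinearEquiv.coe_coe, LinearEquiv.symm_apply_apply,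
    LinearMap.quotKerEquivRange_apply_mk, Submodule.liftQ_apply] at h
  simp only [L, Fintype.linearCombination_apply_single, one_smul] at h
  rw [← h, mul_comm, ← smul_eq_mul, ← map_smul, smul_eq_mul, mul_one]

/-- Linear relations with coefficients in a flat extension are consequences of relations over the
base ring. -/
theorem RingHom.Flat.sum_mul_eq_zero_of_relations {A B κ : Type*} [CommRing A] [CommRing B]
    [Fintype κ] {f : A →+* B} (hf : f.Flat) {a b : κ → A}
    (hab : ∀ s : κ → A, ∑ k, s k * a k = 0 → f (∑ k, s k * b k) = 0)
    {r : κ → B} (hr : ∑ k, r k * f (a k) = 0) : ∑ k, r k * f (b k) = 0 := by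
  algebraize [f]
  have hsmul : ∀ (x : A) (y : B), x • y = f x * y := fun _ _ ↦ rfl
  have : Module.Flat A B := hf
  obtain ⟨m, s, y, hy, hs⟩ : Module.IsTrivialRelation a r :=
    Module.Flat.isTrivialRelation_of_sum_smul_eq_zero (by simpa [hsmul, mul_comm] using hr)
  calc ∑ k, r k * f (b k) = ∑ k, ∑ j, y j * f (s k j * b k) := by
        refine Finset.sum_congr rfl fun k _ ↦ ?_
        rw [hy k, Finset.sum_mul]
        refine Finset.sum_congr rfl fun j _ ↦ ?_
        rw [hsmul, map_mul]
        ring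
    _ = ∑ j, y j * f (∑ k, s k j * b k) := by
        rw [Finset.sum_comm]
        simp only [map_sum, Finset.mul_sum]
    _ = 0 := Finset.sum_eq_zero fun j _ ↦ by
        rw [hab (fun k ↦ s k j) (by simpa [mul_comm] using hs j), mul_zero]

/-- The module of relations of a finite family generating a finitely presented ideal is finitely
generated. -/
theorem fg_ker_linearCombination {S κ : Type*} [CommRing S] [Fintype κ]
    (hcoh : ∀ I : Ideal S, I.FG → Module.FinitePresentation S I) (a : κ → S) :
    (LinearMap.ker (Fintype.linearCombination S a)).FG := by
  have := hcoh (LinearMap.range (Fintype.linearCombination S a))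
    (by rw [← Submodule.map_top]; exact Module.Finite.fg_top.map _)
  rw [← LinearMap.ker_rangeRestrict]
  exact Module.FinitePresentation.fg_ker _ (LinearMap.surjective_rangeRestrict _)

namespace Ring.DirectLimit

variable {ι : Type*} [Preorder ι] [IsDirected ι (· ≤ ·)] {G : ι → Type*} [∀ i, CommRing (G i)]
  {f : ∀ i j, i ≤ j → G i →+* G j}

/-- A finite family of elements of a direct limit lifts to a single stage. -/
theorem exists_of_finite [Nonempty ι] {κ : Type*} [Finite κ]
    (a : κ → Ring.DirectLimit G fun i j h => f i j h) :
    ∃ (i : ι) (a' : κ → G i), ∀ k, of G (fun i j h => f i j h) i (a' k) = a k := by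
  choose i x hx using fun k ↦ exists_of (a k)
  obtain ⟨j, hj⟩ := Finite.exists_le i
  exact ⟨j, fun k ↦ f (i k) j (hj k) (x k), fun k ↦ by rw [of_f, hx]⟩

/-- A finite family of elements vanishing in a direct limit vanishes at a single stage. -/
theorem exists_map_eq_zero_of_finite [DirectedSystem G fun i j h => f i j h]
    {κ : Type*} [Finite κ] {i : ι} (x : κ → G i)
    (hx : ∀ k, of G (fun i j h => f i j h) i (x k) = 0) :
    ∃ (j : ι) (hij : i ≤ j), ∀ k, f i j hij (x k) = 0 := by
  have : Nonempty ι := ⟨i⟩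
  choose j hj h0 using fun k ↦ of.zero_exact (hx k)
  obtain ⟨l, hl⟩ := Finite.exists_le (fun o : Option κ ↦ o.elim i j)
  refine ⟨l, hl none, fun k ↦ ?_⟩
  have h := DirectedSystem.map_map (f := fun i j h => f i j h) (hj k) (hl (some k)) (x k)
  exact h.symm.trans ((congrArg _ (h0 k)).trans (map_zero (f (j k) l (hl (some k)))))

end Ring.DirectLimit


/-- Let `(Rᵢ)` be a directed system of commutative rings with directed colimit `R`, such
that every transition map `Rᵢ → Rⱼ` is flat and each `Rᵢ` is coherent (every finitely
generated ideal is finitely presented) and self-`ℵ₀`-injective (every linear map from a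
finitely generated ideal of `Rᵢ` to `Rᵢ` extends to `Rᵢ`). Then `R` is
self-`ℵ₀`-injective: every `R`-linear map from a finitely generated ideal of `R` to `R`
extends to an `R`-linear endomorphism of `R`. -/
theorem stmt_4 {ι : Type v} [Preorder ι] [IsDirected ι (· ≤ ·)] [Nonempty ι]
    (G : ι → Type w) [∀ i, CommRing (G i)]
    (f : ∀ i j, i ≤ j → G i →+* G j)
    [DirectedSystem G fun i j h => f i j h]
    (hflat : ∀ (i j : ι) (h : i ≤ j), (f i j h).Flat)
    (hcoh : ∀ i : ι, ∀ I : Ideal (G i), I.FG → Module.FinitePresentation (G i) I)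
    (hinj : ∀ i : ι, ∀ I : Ideal (G i), I.FG →
      ∀ φ : I →ₗ[G i] G i, ∃ g : G i →ₗ[G i] G i, ∀ x : I, g (x : G i) = φ x) :
    ∀ I : Ideal (Ring.DirectLimit G fun i j h => f i j h), I.FG →
      ∀ φ : I →ₗ[Ring.DirectLimit G fun i j h => f i j h]
            Ring.DirectLimit G fun i j h => f i j h,
        ∃ g : (Ring.DirectLimit G fun i j h => f i j h) →ₗ[Ring.DirectLimit G fun i j h => f i j h]
            Ring.DirectLimit G fun i j h => f i j h,
          ∀ x : I, g (x : Ring.DirectLimit G fun i j h => f i j h) = φ x := by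
  intro I hI φ
  obtain ⟨n, a, rfl⟩ := Submodule.fg_iff_exists_fin_generating_family.mp hI
  have hmem (k : Fin n) : a k ∈
      Submodule.span (Ring.DirectLimit G fun i j h => f i j h) (Set.range a) :=
    Submodule.subset_span (Set.mem_range_self k)
  obtain ⟨i, ab, hab⟩ := Ring.DirectLimit.exists_of_finite (Sum.elim a fun k ↦ φ ⟨a k, hmem k⟩)
  have ha (k : Fin n) : Ring.DirectLimit.of G (fun i j h => f i j h) i (ab (.inl k)) = a k :=
    hab (.inl k)
  have hb (k : Fin n) :
      Ring.DirectLimit.of G (fun i j h => f i j h) i (ab (.inr k)) = φ ⟨a k, hmem k⟩ :=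
    hab (.inr k)
  have hrel (s : Fin n → G i) (hs : ∑ k, s k * ab (.inl k) = 0) :
      Ring.DirectLimit.of G (fun i j h => f i j h) i (∑ k, s k * ab (.inr k)) = 0 := by
    have h : ∑ k, Ring.DirectLimit.of G (fun i j h => f i j h) i (s k) •
        (⟨a k, hmem k⟩ : Submodule.span _ (Set.range a)) = 0 := by
      ext
      simpa [ha] using congrArg (Ring.DirectLimit.of G (fun i j h => f i j h) i) hs
    have h' := congrArg φ h
    simp only [map_sum, map_smul, map_zero, smul_eq_mul] at h'
    simpa [hb] using h'
  obtain ⟨T, hT⟩ := fg_ker_linearCombination (hcoh i) fun k ↦ ab (.inl k)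
  obtain ⟨j, hij, hj⟩ := Ring.DirectLimit.exists_map_eq_zero_of_finite (f := f)
    (fun t : T ↦ ∑ k, t.1 k * ab (.inr k)) fun t ↦ hrel t.1 <| by
      have h : t.1 ∈ LinearMap.ker (Fintype.linearCombination (G i) fun k ↦ ab (.inl k)) :=
        hT ▸ Submodule.subset_span t.2
      simpa [Fintype.linearCombination_apply] using h
  have hle : LinearMap.ker (Fintype.linearCombination (G i) fun k ↦ ab (.inl k)) ≤
      Submodule.comap (Fintype.linearCombination (G i) fun k ↦ ab (.inr k))
        (RingHom.ker (f i j hij)) := by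
    rw [← hT, Submodule.span_le]
    intro t ht
    simpa [Fintype.linearCombination_apply, RingHom.mem_ker] using hj ⟨t, ht⟩
  obtain ⟨c, hc⟩ := exists_mul_eq_of_relations (hinj j) (fun k ↦ f i j hij (ab (.inl k)))
    (fun k ↦ f i j hij (ab (.inr k))) fun r hr ↦
      (hflat i j hij).sum_mul_eq_zero_of_relations (fun s hs ↦ by
        have h := hle (x := s) (by simpa [Fintype.linearCombination_apply] using hs)
        simpa [Fintype.linearCombination_apply, RingHom.mem_ker] using h) hr
  refine ⟨LinearMap.mulLeft _ (Ring.DirectLimit.of G (fun i j h => f i j h) j c), ?_⟩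
  have hgen (k : Fin n) :
      Ring.DirectLimit.of G (fun i j h => f i j h) j c * a k = φ ⟨a k, hmem k⟩ := by
    rw [← hb, ← ha, ← Ring.DirectLimit.of_f hij, ← Ring.DirectLimit.of_f hij, ← map_mul, hc]
  rintro ⟨x, hx⟩
  obtain ⟨r, rfl⟩ := (Submodule.mem_span_range_iff_exists_fun _).mp hx
  have h : (⟨∑ k, r k • a k, hx⟩ : Submodule.span _ (Set.range a)) =
      ∑ k, r k • ⟨a k, hmem k⟩ := by
    ext
    simp
  rw [congrArg φ h]
  simp only [map_sum, map_smul, ← hgen, LinearMap.mulLeft_apply, smul_eq_mul,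
    mul_left_comm]
end

section
/- There exists a commutative local integral domain R with maximal ideal m which is separated (⋂_{n>0} m^n = 0), together with an element x ∈ m, such that the maximal ideal of the quotient ring R/(x) is nonzero and idempotent (equal to its own square). -/
open IsLocalRing

/-- The lacunary power series `∑ vⱼ X ^ (2 ^ j)`. -/
noncomputable def dyadicSeries (v : ℕ → ZMod 2) : PowerSeries (ZMod 2) :=
  PowerSeries.mk fun i => if i = 2 ^ Nat.log 2 i then v (Nat.log 2 i) else 0

theorem coeff_dyadicSeries_two_pow (v : ℕ → ZMod 2) (j : ℕ) :
    PowerSeries.coeff (2 ^ j) (dyadicSeries v) = v j := by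
  simp [dyadicSeries, Nat.log_pow]

theorem dyadicSeries_injective : Function.Injective dyadicSeries := by
  intro v w h
  ext j
  rw [← coeff_dyadicSeries_two_pow v, h, coeff_dyadicSeries_two_pow]

theorem constantCoeff_dyadicSeries (v : ℕ → ZMod 2) :
    PowerSeries.constantCoeff (dyadicSeries v) = 0 := by
  simp [dyadicSeries, ← PowerSeries.coeff_zero_eq_constantCoeff_apply]

theorem PowerSeries.sq_eq_expand_zmod_two (f : PowerSeries (ZMod 2)) :
    f ^ 2 = f.expand 2 two_ne_zero := by
  have h := MvPowerSeries.map_frobenius_expand 2 two_ne_zero (f := f)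
  rw [ZMod.frobenius_zmod, MvPowerSeries.map_id] at h
  exact h.symm

theorem dyadicSeries_eq (v : ℕ → ZMod 2) :
    dyadicSeries v = PowerSeries.C (v 0) * PowerSeries.X +
      dyadicSeries (fun j => v (j + 1)) ^ 2 := by
  ext i
  rw [PowerSeries.sq_eq_expand_zmod_two, map_add, PowerSeries.coeff_expand,
    PowerSeries.coeff_C_mul, PowerSeries.coeff_X]
  obtain ⟨k, rfl | rfl⟩ := Nat.even_or_odd' i
  · rcases Nat.eq_zero_or_pos k with rfl | hk
    · simp [dyadicSeries]
    · have hlog : Nat.log 2 (2 * k) = Nat.log 2 k + 1 := by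
        rw [mul_comm, Nat.log_mul_base one_lt_two hk.ne']
      have : 2 * k ≠ 1 := by omega
      simp [dyadicSeries, hlog, this, pow_succ, mul_comm _ 2]
  · have h2 : ¬ 2 ∣ 2 * k + 1 := by omega
    rcases Nat.eq_zero_or_pos k with rfl | hk
    · simp [dyadicSeries]
    · have h3 : 2 * k + 1 ≠ 1 := by omega
      have h4 : 2 * k + 1 ≠ 2 ^ Nat.log 2 (2 * k + 1) := by
        intro h
        have hlog : Nat.log 2 (2 * k + 1) ≠ 0 := (Nat.log_pos one_lt_two (by omega)).ne'
        exact h2 (h ▸ dvd_pow_self 2 hlog)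
      simp only [dyadicSeries, PowerSeries.coeff_mk, if_neg h2, if_neg h3, if_neg h4]
      simp

instance : Module.IsTorsionFree (Polynomial (ZMod 2)) (PowerSeries (ZMod 2)) := by
  have : FaithfulSMul (Polynomial (ZMod 2)) (PowerSeries (ZMod 2)) := by
    rw [faithfulSMul_iff_algebraMap_injective]
    intro p q h
    simpa [PowerSeries.algebraMap_apply'] using h
  infer_instance

theorem exists_transcendental_dyadicSeries :
    ∃ v, Transcendental (Polynomial (ZMod 2)) (dyadicSeries v) := by
  by_contra! h
  have : Countable (Polynomial (ZMod 2)) := by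
    rw [← Cardinal.mk_le_aleph0_iff]
    exact Polynomial.cardinalMk_le_max.trans (by simp)
  have hc := (Algebraic.countable (Polynomial (ZMod 2)) (PowerSeries (ZMod 2))).preimage
    dyadicSeries_injective
  have huniv : dyadicSeries ⁻¹' {x | IsAlgebraic (Polynomial (ZMod 2)) x} = Set.univ := by
    ext v
    simpa [Transcendental] using h v
  rw [huniv, Set.countable_univ_iff, ← Cardinal.mk_le_aleph0_iff] at hc
  simp at hc
  exact absurd hc (Cardinal.cantor _).not_ge

section Tower

open Polynomial

variable {v : ℕ → ZMod 2}

theorem dyadicSeries_shift_eq (v : ℕ → ZMod 2) (n : ℕ) :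
    dyadicSeries (fun j => v (n + j)) =
      algebraMap (ZMod 2)[X] (PowerSeries (ZMod 2)) (C (v n) * X) +
        dyadicSeries (fun j => v (n + 1 + j)) ^ 2 := by
  rw [dyadicSeries_eq]
  simp [PowerSeries.algebraMap_apply', add_assoc, add_comm 1]

theorem transcendental_dyadicSeries_shift
    (hv : Transcendental (ZMod 2)[X] (dyadicSeries v)) (n : ℕ) :
    Transcendental (ZMod 2)[X] (dyadicSeries fun j => v (n + j)) := by
  induction n with
  | zero => simpa using hv
  | succ n ih =>
    intro h
    apply ih
    rw [dyadicSeries_shift_eq]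
    exact (isAlgebraic_algebraMap _).add (h.pow 2)

/-- The algebra generated over `𝔽₂[X]` by all the shifts of a dyadic series. -/
noncomputable def dyadicAlgebra (v : ℕ → ZMod 2) :
    Subalgebra (ZMod 2)[X] (PowerSeries (ZMod 2)) :=
  Algebra.adjoin _ (Set.range fun n => dyadicSeries fun j => v (n + j))

/-- The generators of `dyadicAlgebra v`. -/
noncomputable def dyadicAlgebra.gen (v : ℕ → ZMod 2) (n : ℕ) : dyadicAlgebra v :=
  ⟨dyadicSeries fun j => v (n + j), Algebra.subset_adjoin ⟨n, rfl⟩⟩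

namespace dyadicAlgebra

theorem gen_eq (v : ℕ → ZMod 2) (n : ℕ) :
    gen v n = algebraMap (ZMod 2)[X] _ (C (v n) * X) + gen v (n + 1) ^ 2 :=
  Subtype.ext (dyadicSeries_shift_eq v n)

theorem adjoin_gen_monotone (v : ℕ → ZMod 2) :
    Monotone fun n => Algebra.adjoin (ZMod 2)[X] {gen v n} := by
  refine monotone_nat_of_le_succ fun n => ?_
  rw [Algebra.adjoin_le_iff, Set.singleton_subset_iff, SetLike.mem_coe, gen_eq v n]
  exact add_mem (Subalgebra.algebraMap_mem _ _)
    (pow_mem (Algebra.self_mem_adjoin_singleton _ _) 2)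

theorem iSup_adjoin_gen (v : ℕ → ZMod 2) :
    ⨆ n, Algebra.adjoin (ZMod 2)[X] {gen v n} = ⊤ := by
  rw [← Algebra.adjoin_iUnion, Set.iUnion_singleton_eq_range]
  apply Subalgebra.map_injective (f := (dyadicAlgebra v).val) Subtype.val_injective
  rw [AlgHom.map_adjoin, ← Set.range_comp, Algebra.map_top, Subalgebra.range_val]
  rfl

theorem exists_aeval_gen_eq (a b : dyadicAlgebra v) :
    ∃ n, ∃ P Q : (ZMod 2)[X][X], aeval (gen v n) P = a ∧ aeval (gen v n) Q = b := by
  have key (a : dyadicAlgebra v) : ∃ n, a ∈ Algebra.adjoin (ZMod 2)[X] {gen v n} := by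
    have ha : a ∈ ((⨆ n, Algebra.adjoin (ZMod 2)[X] {gen v n} : Subalgebra _ _) : Set _) := by
      rw [iSup_adjoin_gen]
      trivial
    rwa [Subalgebra.coe_iSup_of_directed (adjoin_gen_monotone v).directed_le,
      Set.mem_iUnion] at ha
  obtain ⟨n, hn⟩ := key a
  obtain ⟨m, hm⟩ := key b
  have hn' := adjoin_gen_monotone v (le_max_left n m) hn
  have hm' := adjoin_gen_monotone v (le_max_right n m) hm
  simp only [Algebra.adjoin_singleton_eq_range_aeval, AlgHom.mem_range] at hn' hm'
  obtain ⟨P, hP⟩ := hn'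
  obtain ⟨Q, hQ⟩ := hm'
  exact ⟨_, P, Q, hP, hQ⟩

/-- The constant coefficient, as a ring homomorphism on `dyadicAlgebra v`. -/
noncomputable def augmentation (v : ℕ → ZMod 2) : dyadicAlgebra v →+* ZMod 2 :=
  (PowerSeries.constantCoeff (R := ZMod 2)).comp (dyadicAlgebra v).val.toRingHom

@[simp]
theorem augmentation_gen (n : ℕ) : augmentation v (gen v n) = 0 :=
  constantCoeff_dyadicSeries fun j => v (n + j)

@[simp]
theorem augmentation_algebraMap (p : (ZMod 2)[X]) :
    augmentation v (algebraMap _ _ p) = p.coeff 0 := by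
  change PowerSeries.constantCoeff (algebraMap (ZMod 2)[X] (PowerSeries (ZMod 2)) p) = _
  simp [PowerSeries.algebraMap_apply']

theorem aeval_gen_eq (n : ℕ) (P : (ZMod 2)[X][X]) :
    aeval (gen v n) P = aeval (gen v n) P.divX * gen v n + algebraMap _ _ (P.coeff 0) := by
  conv_lhs => rw [← P.divX_mul_X_add]
  simp

theorem augmentation_aeval (n : ℕ) (P : (ZMod 2)[X][X]) :
    augmentation v (aeval (gen v n) P) = (P.coeff 0).coeff 0 := by
  rw [aeval_gen_eq]
  simp

theorem aeval_gen_injective (hv : Transcendental (ZMod 2)[X] (dyadicSeries v)) (n : ℕ) :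
    Function.Injective (aeval (gen v n) : (ZMod 2)[X][X] →ₐ[(ZMod 2)[X]] dyadicAlgebra v) := by
  rw [← transcendental_iff_injective]
  intro h
  exact transcendental_dyadicSeries_shift hv n (h.algHom (dyadicAlgebra v).val)

theorem ker_augmentation_le (v : ℕ → ZMod 2) :
    RingHom.ker (augmentation v) ≤
      RingHom.ker (augmentation v) ^ 2 ⊔ Ideal.span {algebraMap (ZMod 2)[X] _ X} := by
  intro a ha
  obtain ⟨n, P, -, rfl, -⟩ := exists_aeval_gen_eq a a
  have hx : algebraMap (ZMod 2)[X] (dyadicAlgebra v) X ∈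
      RingHom.ker (augmentation v) ^ 2 ⊔ Ideal.span {algebraMap (ZMod 2)[X] _ X} :=
    Ideal.mem_sup_right (Ideal.mem_span_singleton_self _)
  rw [RingHom.mem_ker, augmentation_aeval] at ha
  rw [aeval_gen_eq, gen_eq, ← (P.coeff 0).divX_mul_X_add, ha]
  simp only [map_mul, map_zero, add_zero]
  refine add_mem (Ideal.mul_mem_left _ _ (add_mem (Ideal.mul_mem_left _ _ hx) ?_))
    (Ideal.mul_mem_left _ _ hx)
  exact Ideal.mem_sup_left (Ideal.pow_mem_pow (augmentation_gen _) 2)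

theorem exists_gen_zero_eq_aeval (v : ℕ → ZMod 2) (n : ℕ) :
    ∃ P : (ZMod 2)[X][X], aeval (gen v n) P = gen v 0 ∧
      ∃ e, P.map (evalRingHom 0) = X ^ e := by
  induction n with
  | zero => exact ⟨X, by simp, 1, by simp⟩
  | succ n ih =>
    obtain ⟨P, hP, e, he⟩ := ih
    refine ⟨P.comp (C (C (v n) * X) + X ^ 2), ?_, 2 * e, ?_⟩
    · rw [aeval_comp, ← hP, gen_eq v n]
      simp
    · rw [map_comp, he]
      simp [pow_mul]

theorem augmentation_eq_zero_of_gen_mul_eq (hv : Transcendental (ZMod 2)[X] (dyadicSeries v))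
    {a b : dyadicAlgebra v} (h : gen v 0 * b = algebraMap (ZMod 2)[X] _ X * a) :
    augmentation v b = 0 := by
  obtain ⟨n, T, Q, rfl, rfl⟩ := exists_aeval_gen_eq a b
  obtain ⟨P, hP, e, he⟩ := exists_gen_zero_eq_aeval v n
  have hPQ : P * Q = C X * T := by
    apply aeval_gen_injective hv n
    simp only [map_mul, hP, h, aeval_C]
  have hmap := congrArg (Polynomial.map (evalRingHom (0 : ZMod 2))) hPQ
  simp only [Polynomial.map_mul, he, map_C, coe_evalRingHom, eval_X, map_zero, zero_mul,
    mul_eq_zero, pow_eq_zero_iff', X_ne_zero, false_and, false_or] at hmap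
  rw [augmentation_aeval, coeff_zero_eq_eval_zero (Q.coeff 0)]
  simpa using congrArg (Polynomial.coeff · 0) hmap

end dyadicAlgebra

end Tower

theorem iInf_maximalIdeal_pow_eq_bot_of_injective {R K : Type*} [CommRing R] [IsLocalRing R]
    [CommRing K] (g : R →+* PowerSeries K) (hg : Function.Injective g)
    (hm : ∀ r ∈ maximalIdeal R, PowerSeries.X ∣ g r) :
    ⨅ n : ℕ, maximalIdeal R ^ (n + 1) = ⊥ := by
  have hle : maximalIdeal R ≤ (Ideal.span {PowerSeries.X}).comap g := fun r hr =>
    Ideal.mem_comap.2 (Ideal.mem_span_singleton.2 (hm r hr))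
  rw [eq_bot_iff]
  intro r hr
  rw [Ideal.mem_iInf] at hr
  rw [Ideal.mem_bot, ← map_eq_zero_iff g hg]
  ext n
  have hn : g r ∈ Ideal.span {(PowerSeries.X : PowerSeries K)} ^ (n + 1) :=
    Ideal.mem_comap.1 (Ideal.le_comap_pow g (n + 1) (Ideal.pow_right_mono hle (n + 1) (hr n)))
  rw [Ideal.span_singleton_pow, Ideal.mem_span_singleton] at hn
  exact PowerSeries.X_pow_dvd_iff.1 hn n n.lt_succ_self

theorem map_mk_span_singleton_sq_eq {R : Type*} [CommRing R] {I : Ideal R} {x : R}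
    (h : I ≤ I ^ 2 ⊔ Ideal.span {x}) :
    (I.map (Ideal.Quotient.mk (Ideal.span {x}))) ^ 2 =
      I.map (Ideal.Quotient.mk (Ideal.span {x})) := by
  refine le_antisymm (Ideal.pow_le_self two_ne_zero) ?_
  refine (Ideal.map_mono h).trans ?_
  rw [Ideal.map_sup, Ideal.map_quotient_self, sup_bot_eq, Ideal.map_pow]

theorem isMaximal_map_mk_span_singleton {R : Type*} [CommRing R] [IsLocalRing R] {x : R}
    (hx : x ∈ maximalIdeal R) :
    ((maximalIdeal R).map (Ideal.Quotient.mk (Ideal.span {x}))).IsMaximal := by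
  refine Ideal.IsMaximal.map_of_surjective_of_ker_le Ideal.Quotient.mk_surjective ?_
  rwa [Ideal.mk_ker, Ideal.span_singleton_le_iff_mem]

/-- There exists a commutative local integral domain `R` with maximal ideal `m` which is
separated (`⋂_{n>0} mⁿ = 0`), together with an element `x ∈ m`, such that the maximal
ideal of the quotient ring `R/(x)` (the image of `m`) is nonzero and idempotent. -/
theorem stmt_7 :
    ∃ (R : Type) (_ : CommRing R) (_ : IsDomain R) (_ : IsLocalRing R) (x : R),
      x ∈ maximalIdeal R ∧
      (⨅ n : ℕ, (maximalIdeal R) ^ (n + 1)) = ⊥ ∧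
      ((maximalIdeal R).map (Ideal.Quotient.mk (Ideal.span {x}))).IsMaximal ∧
      (maximalIdeal R).map (Ideal.Quotient.mk (Ideal.span {x})) ≠ ⊥ ∧
      ((maximalIdeal R).map (Ideal.Quotient.mk (Ideal.span {x}))) ^ 2 =
        (maximalIdeal R).map (Ideal.Quotient.mk (Ideal.span {x})) := by
  obtain ⟨v, hv⟩ := exists_transcendental_dyadicSeries
  let p := RingHom.ker (dyadicAlgebra.augmentation v)
  have : p.IsPrime := RingHom.ker_isPrime _
  let A := dyadicAlgebra v
  let R := Localization.AtPrime p
  let ι := algebraMap A R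
  let t : A := algebraMap (Polynomial (ZMod 2)) A Polynomial.X
  have hmax : p.map ι = maximalIdeal R := Localization.AtPrime.map_eq_maximalIdeal
  have ht : t ∈ p := by
    rw [RingHom.mem_ker, dyadicAlgebra.augmentation_algebraMap, Polynomial.coeff_X_zero]
  have hιt : ι t ∈ maximalIdeal R := hmax ▸ Ideal.mem_map_of_mem ι ht
  have hunit (b : p.primeCompl) : IsUnit ((A.val : A →+* PowerSeries (ZMod 2)) b) := by
    rw [PowerSeries.isUnit_iff_constantCoeff, isUnit_iff_ne_zero]
    exact b.2
  let g : R →+* PowerSeries (ZMod 2) := IsLocalization.lift hunit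
  have hle : p.primeCompl ≤ nonZeroDivisors A := p.primeCompl_le_nonZeroDivisors
  have hg : Function.Injective g := by
    rw [IsLocalization.lift_injective_iff]
    intro a b
    rw [(IsLocalization.injective R hle).eq_iff]
    exact Subtype.val_injective.eq_iff.symm
  refine ⟨R, inferInstance, IsLocalization.isDomain_of_le_nonZeroDivisors R hle, inferInstance,
    ι t, hιt, iInf_maximalIdeal_pow_eq_bot_of_injective g hg ?_,
    isMaximal_map_mk_span_singleton hιt, ?_, map_mk_span_singleton_sq_eq ?_⟩
  · have : maximalIdeal R ≤ (Ideal.span {PowerSeries.X}).comap g := by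
      rw [← hmax, Ideal.map_le_iff_le_comap]
      intro a ha
      rw [Ideal.mem_comap, Ideal.mem_comap, IsLocalization.lift_eq, Ideal.mem_span_singleton,
        PowerSeries.X_dvd_iff]
      exact ha
    exact fun r hr => Ideal.mem_span_singleton.1 (this hr)
  · intro h
    rw [Ideal.map_eq_bot_iff_le_ker, Ideal.mk_ker] at h
    have hy : ι (dyadicAlgebra.gen v 0) ∈ (Ideal.span {t}).map ι := by
      rw [Ideal.map_span, Set.image_singleton]
      exact h (hmax ▸ Ideal.mem_map_of_mem ι (dyadicAlgebra.augmentation_gen 0))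
    rw [IsLocalization.mem_map_algebraMap_iff p.primeCompl] at hy
    obtain ⟨⟨⟨c, hc⟩, b⟩, hcb⟩ := hy
    obtain ⟨a, rfl⟩ := Ideal.mem_span_singleton.1 hc
    rw [← map_mul] at hcb
    exact b.2 (dyadicAlgebra.augmentation_eq_zero_of_gen_mul_eq hv
      (IsLocalization.injective R hle hcb))
  · rw [← hmax, ← Set.image_singleton, ← Ideal.map_span, ← Ideal.map_pow, ← Ideal.map_sup]
    exact Ideal.map_mono (dyadicAlgebra.ker_augmentation_le v)
end

section
/- Let R be a commutative ring, let V ⊆ Spec R be a Thomason subset (a union of sets V(I) = {p ∈ Spec R : I ⊆ p} with I finitely generated), and let W be an injective R-module such that Hom_R(R/I, W) = 0 for every finitely generated ideal I with V(I) ⊆ V. Then the canonical map W → ∏_{p ∉ V} W_p into the product of the localizations of W at the primes outside V is a split monomorphism of R-modules. -/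
open PrimeSpectrum

open Filter in
/-- A prime ideal obtained from a family of primes as a limit along an ultrafilter. -/
def PrimeSpectrum.ultrafilterLim {R ι : Type*} [CommRing R] (U : Ultrafilter ι)
    (P : ι → PrimeSpectrum R) : PrimeSpectrum R where
  asIdeal :=
    { carrier := {r | ∀ᶠ i in (U : Filter ι), r ∈ (P i).asIdeal}
      add_mem' := fun ha hb => by
        filter_upwards [ha, hb] with i h1 h2 using add_mem h1 h2
      zero_mem' := Eventually.of_forall fun i => zero_mem _
      smul_mem' := fun c x hx => by
        filter_upwards [hx] with i h using Ideal.mul_mem_left _ c h }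
  isPrime := by
    refine ⟨fun h => ?_, fun {a b} hab => ?_⟩
    · obtain ⟨i, hi⟩ := Eventually.exists ((Ideal.eq_top_iff_one _).1 h)
      exact (Ideal.ne_top_iff_one _).1 (P i).isPrime.ne_top hi
    · exact Ultrafilter.eventually_or.1
        (Eventually.mono hab fun i hi => (P i).isPrime.mem_or_mem hi)

open Filter in
theorem PrimeSpectrum.mem_ultrafilterLim {R ι : Type*} [CommRing R] {U : Ultrafilter ι}
    {P : ι → PrimeSpectrum R} {r : R} :
    r ∈ (ultrafilterLim U P).asIdeal ↔ ∀ᶠ i in (U : Filter ι), r ∈ (P i).asIdeal :=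
  Iff.rfl

open Filter in
/-- If `V` is Thomason and `V(J) ⊆ V`, then already `V(I) ⊆ V` for some finitely generated
`I ≤ J`. -/
theorem PrimeSpectrum.exists_fg_le_zeroLocus_subset {R : Type*} [CommRing R]
    {V : Set (PrimeSpectrum R)}
    (hV : ∀ p ∈ V, ∃ I : Ideal R, I.FG ∧ zeroLocus (I : Set R) ⊆ V ∧ p ∈ zeroLocus (I : Set R))
    {J : Ideal R} (hJ : zeroLocus (J : Set R) ⊆ V) :
    ∃ I : Ideal R, I.FG ∧ I ≤ J ∧ zeroLocus (I : Set R) ⊆ V := by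
  classical
  by_contra! H
  have key (F : Finset J) :
      ∃ p : PrimeSpectrum R, (∀ r ∈ F, (r : R) ∈ p.asIdeal) ∧ p ∉ V := by
    have h := H (Ideal.span ((F.image Subtype.val : Finset R) : Set R)) ⟨_, rfl⟩
      (Ideal.span_le.2 fun r hr => by
        obtain ⟨r, -, rfl⟩ := Finset.mem_image.1 hr
        exact r.2)
    obtain ⟨p, hp, hpV⟩ := Set.not_subset.1 h
    exact ⟨p, fun r hr => hp (Ideal.subset_span (Finset.mem_image_of_mem _ hr)), hpV⟩
  choose P hPmem hPV using key
  let U : Ultrafilter (Finset J) := Ultrafilter.of atTop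
  have hU : (U : Filter (Finset J)) ≤ atTop := Ultrafilter.of_le _
  have hJP : J ≤ (ultrafilterLim U P).asIdeal := fun r hr =>
    mem_ultrafilterLim.2 <| hU <| (eventually_ge_atTop {⟨r, hr⟩}).mono fun F hF =>
      hPmem F ⟨r, hr⟩ (hF (Finset.mem_singleton_self _))
  obtain ⟨I, ⟨S, rfl⟩, hIV, hIP⟩ := hV _ (hJ hJP)
  have hS : ∀ᶠ F in (U : Filter (Finset J)), ∀ r ∈ S, r ∈ (P F).asIdeal :=
    (eventually_all_finset S).2 fun r hr => hIP (Ideal.subset_span hr)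
  obtain ⟨F, hF⟩ := hS.exists
  exact hPV F (hIV (Ideal.span_le.2 hF))

/-- An element of a module vanishing in the localizations at all primes outside `V` has annihilator
whose zero locus lies in `V`. -/
theorem PrimeSpectrum.zeroLocus_torsionOf_subset {R M : Type*} [CommRing R] [AddCommGroup M]
    [Module R M] {V : Set (PrimeSpectrum R)} {x : M}
    (hx : ∀ p ∉ V, LocalizedModule.mkLinearMap p.asIdeal.primeCompl M x = 0) :
    zeroLocus (Ideal.torsionOf R M x : Set R) ⊆ V := by
  intro p hp
  by_contra hpV
  obtain ⟨c, hc⟩ := (IsLocalizedModule.eq_zero_iff p.asIdeal.primeCompl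
    (LocalizedModule.mkLinearMap p.asIdeal.primeCompl M)).1 (hx p hpV)
  exact c.2 (hp ((Ideal.mem_torsionOf_iff x c.1).2 hc))

/-- Let `R` be a commutative ring, `V ⊆ Spec R` a Thomason subset (a union of sets
`V(I)` with `I` finitely generated), and `W` an injective `R`-module such that
`Hom_R(R/I, W) = 0` for every finitely generated ideal `I` with `V(I) ⊆ V`. Then the
canonical map `W → ∏_{p ∉ V} W_p` into the product of the localizations of `W` at the
primes outside `V` is a split monomorphism of `R`-modules. -/
theorem stmt_11 {R : Type u} [CommRing R] (V : Set (PrimeSpectrum R))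
    (hV : ∀ p ∈ V, ∃ I : Ideal R, I.FG ∧ zeroLocus (I : Set R) ⊆ V ∧ p ∈ zeroLocus (I : Set R))
    (W : Type u) [AddCommGroup W] [Module R W] [Module.Injective R W]
    (hW : ∀ I : Ideal R, I.FG → zeroLocus (I : Set R) ⊆ V →
        ∀ f : (R ⧸ I) →ₗ[R] W, f = 0) :
    ∃ g : (∀ p : {p : PrimeSpectrum R // p ∉ V},
            LocalizedModule p.1.asIdeal.primeCompl W) →ₗ[R] W,
      g.comp (LinearMap.pi fun p : {p : PrimeSpectrum R // p ∉ V} =>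
          LocalizedModule.mkLinearMap p.1.asIdeal.primeCompl W) = LinearMap.id := by
  have hinj : Function.Injective (LinearMap.pi fun p : {p : PrimeSpectrum R // p ∉ V} =>
      LocalizedModule.mkLinearMap p.1.asIdeal.primeCompl W) := by
    refine (injective_iff_map_eq_zero _).2 fun x hx => ?_
    obtain ⟨I, hI, hIx, hIV⟩ := exists_fg_le_zeroLocus_subset hV
      (zeroLocus_torsionOf_subset fun p hp => congrFun hx ⟨p, hp⟩)
    have h := hW I hI hIV (Submodule.liftQ I (LinearMap.toSpanSingleton R W x) hIx)
    exact (one_smul R x).symm.trans (LinearMap.congr_fun h (Submodule.Quotient.mk 1))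
  obtain ⟨g, hg⟩ := Module.Injective.out _ hinj (LinearMap.id : W →ₗ[R] W)
  exact ⟨g, LinearMap.ext hg⟩
end

section
/- Let R be a commutative ring and f : R → S a pseudoflat ring epimorphism (an epimorphism in the category of rings with Tor_1^R(S,S) = 0). Then S is flat as an R-module if and only if the restriction of scalars functor from S-modules to R-modules preserves injective objects, i.e., every injective S-module is injective as an R-module. -/
open CategoryTheory

open scoped TensorProduct

/-- Restriction of scalars along a flat algebra preserves injective modules. -/
theorem Module.Injective.of_flat_restrictScalars {R S : Type u} [CommRing R] [CommRing S]
    [Algebra R S] [Module.Flat R S] (M : Type u) [AddCommGroup M] [Module R M] [Module S M]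
    [IsScalarTower R S M] (hM : Module.Injective S M) : Module.Injective R M where
  out X Y _ _ _ _ i hi g := by
    obtain ⟨h, hh⟩ := hM.out (i.baseChange S)
      (Module.Flat.lTensor_preserves_injective_linearMap (M := S) i hi)
      (TensorProduct.AlgebraTensorModule.lift ((LinearMap.lsmul S (X →ₗ[R] M)).flip g))
    refine ⟨h.restrictScalars R ∘ₗ TensorProduct.mk R S Y 1, fun x ↦ ?_⟩
    simpa using hh (1 ⊗ₜ x)

/-- Every module embeds into an injective module over the same ring. -/
theorem Module.Injective.exists_injective_linearMap (S : Type u) [Ring S] (N : Type u)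
    [AddCommGroup N] [Module S N] :
    ∃ (E : ModuleCat.{u} S) (j : N →ₗ[S] E), Module.Injective S E ∧ Function.Injective j := by
  obtain ⟨P⟩ := EnoughInjectives.presentation (ModuleCat.of S N)
  have := P.injective
  exact ⟨P.J, P.f.hom, Module.injective_module_of_injective_object S P.J,
    (ModuleCat.mono_iff_injective P.f).mp P.mono⟩

/-- An algebra is flat if restriction of scalars along it preserves injective modules. -/
theorem Module.Flat.of_restrictScalars_injective {R S : Type u} [CommRing R] [CommRing S]
    [Algebra R S]
    (H : ∀ (M : Type u) [AddCommGroup M] [Module R M] [Module S M] [IsScalarTower R S M],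
      Module.Injective S M → Module.Injective R M) : Module.Flat R S := by
  rw [Module.Flat.iff_lTensor_preserves_injective_linearMap]
  intro A B _ _ _ _ i hi
  obtain ⟨E, j, hE, hj⟩ := Module.Injective.exists_injective_linearMap S (S ⊗[R] A)
  let : Module R E := Module.compHom E (algebraMap R S)
  have : IsScalarTower R S E := IsScalarTower.of_algebraMap_smul fun _ _ ↦ rfl
  obtain ⟨h, hh⟩ := (H E hE).out i hi (j.restrictScalars R ∘ₗ TensorProduct.mk R S A 1)
  let k : S ⊗[R] B →ₗ[S] E :=
    TensorProduct.AlgebraTensorModule.lift ((LinearMap.lsmul S (B →ₗ[R] E)).flip h)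
  have hk : k ∘ₗ i.baseChange S = j := by
    ext a
    simpa [k] using hh a
  refine Function.Injective.of_comp (f := k) ?_
  rw [← hk] at hj
  exact hj

/-- Let `R` be a commutative ring and `f : R → S` a pseudoflat ring epimorphism
(an epimorphism in the category of rings, equivalently the multiplication map
`S ⊗_R S → S` is an isomorphism, with `Tor₁ᴿ(S,S) = 0`). Then `S` is flat as an
`R`-module if and only if restriction of scalars from `S`-modules to `R`-modules
preserves injective objects. -/
theorem stmt_12 {R S : Type u} [CommRing R] [CommRing S] [Algebra R S]
    (hepi : Function.Bijective (LinearMap.mul' R S))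
    (hpseudoflat : Limits.IsZero
        (((Tor (ModuleCat.{u} R) 1).obj (ModuleCat.of R S)).obj (ModuleCat.of R S))) :
    Module.Flat R S ↔
      ∀ (M : Type u) [AddCommGroup M] [Module R M] [Module S M] [IsScalarTower R S M],
        Module.Injective S M → Module.Injective R M :=
  ⟨fun _ M _ _ _ _ hM ↦ Module.Injective.of_flat_restrictScalars (S := S) M hM,
    fun H ↦ Module.Flat.of_restrictScalars_injective H⟩
end

section
/- Let R be a commutative ring and I, J ideals of R with J ⊆ J² + I. Let 0 → A → B → C → 0 be a short exact sequence of R-modules such that I·B = 0. If J·A = 0 and J·C = 0, then J·B = 0. -/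
/-- Let `R` be a commutative ring and `I, J` ideals of `R` with `J ⊆ J² + I`.
Let `0 → A → B → C → 0` be a short exact sequence of `R`-modules such that `I·B = 0`.
If `J·A = 0` and `J·C = 0`, then `J·B = 0`. -/
theorem stmt_13 {R : Type*} [CommRing R] (I J : Ideal R) (hJI : J ≤ J ^ 2 + I)
    {A B C : Type*} [AddCommGroup A] [AddCommGroup B] [AddCommGroup C]
    [Module R A] [Module R B] [Module R C]
    (f : A →ₗ[R] B) (g : B →ₗ[R] C)
    (hf : Function.Injective f) (hg : Function.Surjective g) (hfg : Function.Exact f g)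
    (hIB : ∀ x ∈ I, ∀ b : B, x • b = 0)
    (hJA : ∀ x ∈ J, ∀ a : A, x • a = 0)
    (hJC : ∀ x ∈ J, ∀ c : C, x • c = 0) :
    ∀ x ∈ J, ∀ b : B, x • b = 0 := by
  have hJJ : J ^ 2 ≤ Module.annihilator R B := by
    rw [pow_two, Ideal.mul_le]
    intro y hy z hz
    rw [Module.mem_annihilator]
    intro b
    obtain ⟨a, ha⟩ := (hfg (z • b)).1 (by rw [map_smul, hJC z hz])
    rw [mul_smul, ← ha, ← map_smul, hJA y hy, map_zero]
  have hI : I ≤ Module.annihilator R B := fun x hx => Module.mem_annihilator.2 (hIB x hx)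
  exact fun x hx => Module.mem_annihilator.1 (sup_le hJJ hI (hJI hx))
end

section
/- There exists a commutative local ring R of Krull dimension zero with maximal ideal m which is separated (⋂_{n>0} m^n = 0) but not purely separated: the canonical map R → R̂ = lim_n R/m^n into the m-adic completion is injective but is not a pure monomorphism of R-modules, i.e., there exists an R-module M such that the induced map M ≅ R ⊗_R M → R̂ ⊗_R M is not injective. -/
open IsLocalRing

/-- A sequence `f` whose products with `a` converge `I`-adically to an element `r ∉ (a)`
obstructs the purity of `R → R̂`. -/
theorem not_injective_rTensor_adicCompletion_of {R : Type*} [CommRing R] (I : Ideal R) {a r : R}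
    (f : ℕ → R) (hf : ∀ n, f n - f (n + 1) ∈ I ^ n) (hr : ∀ n, r - a * f n ∈ I ^ n)
    (har : r ∉ Ideal.span {a}) :
    ¬ Function.Injective
      (LinearMap.rTensor (R ⧸ Ideal.span {a}) (AdicCompletion.of I R)) := by
  intro hinj
  let x : AdicCompletion I R := AdicCompletion.mk I R (AdicCompletion.AdicCauchySequence.mk I R f
    fun n ↦ SModEq.sub_mem.mpr (by simpa using hf n))
  have hx : AdicCompletion.of I R r = a • x := by
    ext n
    rw [AdicCompletion.val_smul_apply]
    change Submodule.Quotient.mk r = Submodule.Quotient.mk (a • f n)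
    rw [Submodule.Quotient.eq]
    simpa using hr n
  have h0 : r ⊗ₜ[R] (Ideal.Quotient.mk (Ideal.span {a}) 1) = 0 := by
    apply hinj
    rw [map_zero, LinearMap.rTensor_tmul, hx, TensorProduct.smul_tmul]
    have : a • (Ideal.Quotient.mk (Ideal.span {a}) 1) = 0 := by
      rw [← Ideal.Quotient.mkₐ_eq_mk R, ← map_smul, Ideal.Quotient.mkₐ_eq_mk,
        Ideal.Quotient.eq_zero_iff_mem]
      simp
    rw [this, TensorProduct.tmul_zero]
  apply har
  have h1 := congrArg (TensorProduct.lid R _) h0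
  rw [map_zero, TensorProduct.lid_tmul, ← Ideal.Quotient.mkₐ_eq_mk R, ← map_smul,
    Ideal.Quotient.mkₐ_eq_mk, Ideal.Quotient.eq_zero_iff_mem] at h1
  simpa using h1

section AdjoinNilpotent

variable {k T : Type*} [Field k] [CommRing T] [Algebra k T] {G : Set T} {N : Ideal T}

theorem exists_sub_algebraMap_mem_of_mem_adjoin (hG : G ⊆ N) {z : T}
    (hz : z ∈ Algebra.adjoin k G) : ∃ c : k, z - algebraMap k T c ∈ N := by
  induction hz using Algebra.adjoin_induction with
  | mem x hx => exact ⟨0, by simpa using hG hx⟩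
  | algebraMap r => exact ⟨r, by simp⟩
  | add x y _ _ hx hy =>
    obtain ⟨c, hc⟩ := hx
    obtain ⟨d, hd⟩ := hy
    refine ⟨c + d, ?_⟩
    rw [map_add, add_sub_add_comm]
    exact add_mem hc hd
  | mul x y _ _ hx hy =>
    obtain ⟨c, hc⟩ := hx
    obtain ⟨d, hd⟩ := hy
    refine ⟨c * d, ?_⟩
    have : x * y - algebraMap k T (c * d) =
        y * (x - algebraMap k T c) + algebraMap k T c * (y - algebraMap k T d) := by
      rw [map_mul]; ring
    rw [this]
    exact add_mem (N.mul_mem_left _ hc) (N.mul_mem_left _ hd)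

theorem isUnit_or_mem_of_adjoin (hG : G ⊆ N) (hN : N ≤ nilradical T) (z : Algebra.adjoin k G) :
    IsUnit z ∨ (z : T) ∈ N := by
  obtain ⟨c, hc⟩ := exists_sub_algebraMap_mem_of_mem_adjoin hG z.2
  obtain rfl | h := eq_or_ne c 0
  · right
    simpa using hc
  · left
    have hnil : IsNilpotent (z - algebraMap k (Algebra.adjoin k G) c) := by
      rw [← IsNilpotent.map_iff (f := (Algebra.adjoin k G).val) Subtype.val_injective]
      exact hN hc
    have hu : IsUnit (algebraMap k (Algebra.adjoin k G) c) := h.isUnit.map _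
    simpa using hnil.isUnit_add_right_of_commute hu (Commute.all _ _)

theorem krullDimLE_zero_and_isLocalRing_adjoin [Nontrivial T] (hG : G ⊆ N)
    (hN : N ≤ nilradical T) :
    Ring.KrullDimLE 0 (Algebra.adjoin k G) ∧ IsLocalRing (Algebra.adjoin k G) := by
  refine ((Ring.krullDimLE_zero_and_isLocalRing_tfae (Algebra.adjoin k G)).out 0 2 rfl rfl).mpr
    fun z ↦ ⟨fun hz hu ↦ hz.not_isUnit hu, fun hu ↦ ?_⟩
  rw [← IsNilpotent.map_iff (f := (Algebra.adjoin k G).val) Subtype.val_injective]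
  exact hN ((isUnit_or_mem_of_adjoin hG hN z).resolve_left hu)

theorem coe_mem_of_mem_maximalIdeal_adjoin (hG : G ⊆ N) (hN : N ≤ nilradical T)
    [IsLocalRing (Algebra.adjoin k G)] {z : Algebra.adjoin k G}
    (hz : z ∈ maximalIdeal (Algebra.adjoin k G)) : (z : T) ∈ N :=
  (isUnit_or_mem_of_adjoin hG hN z).resolve_left hz

end AdjoinNilpotent

namespace SquarefreePowerSeries

open MvPowerSeries

/-- The power series having no squarefree monomial of degree less than `n`. -/
noncomputable def lowOrder (n : ℕ) : Ideal (MvPowerSeries ℕ ℚ) where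
  carrier := {f | ∀ d : ℕ →₀ ℕ, (∀ i, d i ≤ 1) → d.degree < n → coeff d f = 0}
  zero_mem' := by simp
  add_mem' hf hg d hd hn := by rw [map_add, hf d hd hn, hg d hd hn, add_zero]
  smul_mem' g f hf d hd hn := by
    classical
    rw [smul_eq_mul, coeff_mul]
    refine Finset.sum_eq_zero fun p hp ↦ ?_
    obtain rfl := Finset.HasAntidiagonal.mem_antidiagonal.mp hp
    rw [hf p.2 (fun i ↦ le_trans (by simp) (hd i)) (by rw [map_add] at hn; omega), mul_zero]

theorem mem_lowOrder {n : ℕ} {f : MvPowerSeries ℕ ℚ} : f ∈ lowOrder n ↔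
    ∀ d : ℕ →₀ ℕ, (∀ i, d i ≤ 1) → d.degree < n → coeff d f = 0 := Iff.rfl

theorem lowOrder_mul_le (m n : ℕ) : lowOrder m * lowOrder n ≤ lowOrder (m + n) := by
  classical
  rw [Ideal.mul_le]
  intro f hf g hg d hd hn
  rw [coeff_mul]
  refine Finset.sum_eq_zero fun p hp ↦ ?_
  obtain rfl := Finset.HasAntidiagonal.mem_antidiagonal.mp hp
  rw [map_add] at hn
  by_cases h : p.1.degree < m
  · rw [hf p.1 (fun i ↦ le_trans (by simp) (hd i)) h, zero_mul]
  · rw [hg p.2 (fun i ↦ le_trans (by simp) (hd i)) (by omega), mul_zero]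

theorem lowOrder_one_pow_le (n : ℕ) : lowOrder 1 ^ n ≤ lowOrder n := by
  induction n with
  | zero => exact fun f _ d _ h ↦ absurd h (by simp)
  | succ n ih => exact pow_succ (lowOrder 1) n ▸ (Ideal.mul_mono_left ih).trans (lowOrder_mul_le n 1)

theorem X_mem_lowOrder (i : ℕ) : (X i : MvPowerSeries ℕ ℚ) ∈ lowOrder 1 := by
  intro d _ hd
  obtain rfl : d = 0 := (Finsupp.degree_eq_zero_iff d).mp (Nat.lt_one_iff.mp hd)
  exact coeff_zero_X i

/-- The power series having no squarefree monomial at all. -/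
noncomputable def nonSquarefree : Ideal (MvPowerSeries ℕ ℚ) := ⨅ n, lowOrder n

theorem coeff_eq_zero_of_mem_nonSquarefree {f : MvPowerSeries ℕ ℚ} (hf : f ∈ nonSquarefree)
    {d : ℕ →₀ ℕ} (hd : ∀ i, d i ≤ 1) : coeff d f = 0 :=
  (Ideal.mem_iInf.mp hf (d.degree + 1)) d hd (Nat.lt_succ_self _)

theorem X_sq_mem_nonSquarefree (i : ℕ) : (X i : MvPowerSeries ℕ ℚ) ^ 2 ∈ nonSquarefree := by
  classical
  refine Ideal.mem_iInf.mpr fun n d hd _ ↦ ?_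
  rw [coeff_X_pow, if_neg]
  rintro rfl
  simpa using hd i

/-- Formal power series in infinitely many variables of square zero. -/
abbrev Series : Type := MvPowerSeries ℕ ℚ ⧸ nonSquarefree

/-- The quotient map onto `Series`. -/
noncomputable abbrev toSeries : MvPowerSeries ℕ ℚ →ₐ[ℚ] Series := Ideal.Quotient.mkₐ ℚ nonSquarefree

theorem toSeries_eq_zero_iff {f : MvPowerSeries ℕ ℚ} : toSeries f = 0 ↔ f ∈ nonSquarefree :=
  Ideal.Quotient.eq_zero_iff_mem

theorem toSeries_X_sq (i : ℕ) : toSeries (X i) ^ 2 = 0 := by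
  rw [← map_pow, toSeries_eq_zero_iff]
  exact X_sq_mem_nonSquarefree i

instance : Nontrivial Series := by
  refine ⟨⟨1, 0, fun h ↦ ?_⟩⟩
  rw [← map_one toSeries, toSeries_eq_zero_iff] at h
  simpa using coeff_eq_zero_of_mem_nonSquarefree h (d := 0) (by simp)

/-- The nilpotent elements without constant term. -/
noncomputable def nilIdeal : Ideal Series := (lowOrder 1).map toSeries ⊓ nilradical Series

theorem toSeries_X_mem_nilIdeal (i : ℕ) : toSeries (X i) ∈ nilIdeal :=
  ⟨Ideal.mem_map_of_mem _ (X_mem_lowOrder i), 2, toSeries_X_sq i⟩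

theorem eq_zero_of_forall_mem_map_lowOrder {z : Series}
    (hz : ∀ n, z ∈ (lowOrder n).map toSeries) : z = 0 := by
  obtain ⟨f, rfl⟩ := Ideal.Quotient.mk_surjective z
  refine toSeries_eq_zero_iff.mpr (Ideal.mem_iInf.mpr fun n ↦ ?_)
  exact (Ideal.mem_quotient_iff_mem (iInf_le _ n)).mp (hz n)

/-- The exponent of the monomial `X (n + 1) * ⋯ * X m`. -/
noncomputable def blockExp (n m : ℕ) : ℕ →₀ ℕ := ∑ i ∈ Finset.Ico n m, Finsupp.single (i + 1) 1

theorem blockExp_self (n : ℕ) : blockExp n n = 0 := by simp [blockExp]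

theorem blockExp_eq_add {n m : ℕ} (h : n < m) :
    blockExp n m = Finsupp.single (n + 1) 1 + blockExp (n + 1) m :=
  Finset.sum_eq_sum_Ico_succ_bot h _

theorem degree_blockExp (n m : ℕ) : (blockExp n m).degree = m - n := by
  simp [blockExp]

theorem blockExp_apply_zero (n m : ℕ) : blockExp n m 0 = 0 := by
  simp [blockExp, Finsupp.finsetSum_apply]

theorem blockExp_apply_le_one (n m i : ℕ) : blockExp n m i ≤ 1 := by
  classical
  cases i with
  | zero => simp [blockExp_apply_zero]
  | succ i =>
    simp [blockExp, Finsupp.finsetSum_apply, Finsupp.single_apply]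
    split_ifs <;> simp

open Classical in
/-- The power series `1 + X (n + 1) + X (n + 1) * X (n + 2) + ⋯`. -/
noncomputable def tail (n : ℕ) : MvPowerSeries ℕ ℚ :=
  fun d ↦ if ∃ m, n ≤ m ∧ d = blockExp n m then 1 else 0

open Classical in
theorem coeff_tail (n : ℕ) (d : ℕ →₀ ℕ) :
    coeff d (tail n) = if ∃ m, n ≤ m ∧ d = blockExp n m then 1 else 0 := rfl

theorem tail_eq (n : ℕ) : tail n = 1 + X (n + 1) * tail (n + 1) := by
  classical
  ext d
  rw [map_add, coeff_one, X, coeff_monomial_mul, coeff_tail, coeff_tail, one_mul]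
  by_cases h0 : d = 0
  · subst h0
    rw [if_pos ⟨n, le_rfl, (blockExp_self n).symm⟩]
    simp
  · rw [if_neg h0, zero_add, ← ite_and]
    refine if_congr ⟨?_, ?_⟩ rfl rfl
    · rintro ⟨m, hm, rfl⟩
      obtain rfl | hm := hm.eq_or_lt
      · exact absurd (blockExp_self n) h0
      · rw [blockExp_eq_add hm]
        exact ⟨le_add_right le_rfl, m, hm, add_tsub_cancel_left _ _⟩
    · rintro ⟨hd, m, hm, h⟩
      refine ⟨m, by omega, ?_⟩
      rw [blockExp_eq_add hm, ← h, add_tsub_cancel_of_le hd]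

/-- The generators `X i` and `X 0 * tail n` of the example. -/
noncomputable def generators : Set Series :=
  Set.range (fun i ↦ toSeries (X i)) ∪ Set.range (fun n ↦ toSeries (X 0 * tail n))

theorem generators_subset : generators ⊆ nilIdeal := by
  rintro _ (⟨i, rfl⟩ | ⟨n, rfl⟩)
  · exact toSeries_X_mem_nilIdeal i
  · simp only [map_mul]
    exact nilIdeal.mul_mem_right _ (toSeries_X_mem_nilIdeal 0)

/-- The separated zero-dimensional local ring which is not purely separated. -/
noncomputable abbrev Example : Subalgebra ℚ Series := Algebra.adjoin ℚ generators

noncomputable instance : CommRing Example := Subalgebra.toCommRing _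

noncomputable instance : CommSemiring Example := CommRing.toCommSemiring

instance : IsLocalRing Example :=
  (krullDimLE_zero_and_isLocalRing_adjoin generators_subset inf_le_right).2

instance : Ring.KrullDimLE 0 Example :=
  (krullDimLE_zero_and_isLocalRing_adjoin generators_subset inf_le_right).1

theorem coe_mem_map_lowOrder {n : ℕ} {z : Example} (hz : z ∈ maximalIdeal Example ^ n) :
    (z : Series) ∈ (lowOrder n).map toSeries := by
  have h1 : maximalIdeal Example ≤ ((lowOrder 1).map toSeries).comap Example.val := fun z hz ↦
    (coe_mem_of_mem_maximalIdeal_adjoin generators_subset inf_le_right hz).1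
  have h2 := ((Ideal.pow_right_mono h1 n).trans (Ideal.le_comap_pow _ n)) hz
  rw [← Ideal.map_pow] at h2
  exact Ideal.map_mono (lowOrder_one_pow_le n) h2

theorem eq_zero_of_forall_mem_maximalIdeal_pow {z : Example}
    (hz : ∀ n, z ∈ maximalIdeal Example ^ n) : z = 0 :=
  Subtype.ext (eq_zero_of_forall_mem_map_lowOrder fun n ↦ coe_mem_map_lowOrder (hz n))

theorem exists_polynomial_of_mem {z : Series} (hz : z ∈ Example) :
    ∃ (p : MvPolynomial ℕ ℚ) (g : Series),
      z = toSeries (p : MvPowerSeries ℕ ℚ) + toSeries (X 0) * g := by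
  induction hz using Algebra.adjoin_induction with
  | mem x hx =>
    obtain ⟨i, rfl⟩ | ⟨n, rfl⟩ := hx
    · exact ⟨MvPolynomial.X i, 0, by simp⟩
    · exact ⟨0, toSeries (tail n), by simp⟩
  | algebraMap r =>
    refine ⟨MvPolynomial.C r, 0, ?_⟩
    rw [mul_zero, add_zero, MvPolynomial.coe_C]
    exact (toSeries.commutes r).symm
  | add x y _ _ hx hy =>
    obtain ⟨p, g, rfl⟩ := hx
    obtain ⟨q, h, rfl⟩ := hy
    exact ⟨p + q, g + h, by rw [MvPolynomial.coe_add, map_add]; ring⟩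
  | mul x y _ _ hx hy =>
    obtain ⟨p, g, rfl⟩ := hx
    obtain ⟨q, h, rfl⟩ := hy
    exact ⟨p * q, toSeries p * h + g * toSeries q + toSeries (X 0) * g * h, by
      rw [MvPolynomial.coe_mul, map_mul]; ring⟩

theorem X_zero_mul_tail_ne {z : Series} (hz : z ∈ Example) :
    toSeries (X 0 * tail 0) ≠ toSeries (X 0) * z := by
  intro h
  obtain ⟨p, g, rfl⟩ := exists_polynomial_of_mem hz
  have h1 : toSeries (X 0 * (tail 0 - (p : MvPowerSeries ℕ ℚ))) = 0 := by
    rw [mul_sub, map_sub, h, map_mul]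
    linear_combination g * toSeries_X_sq 0
  rw [toSeries_eq_zero_iff] at h1
  let d := blockExp 0 (p.totalDegree + 1)
  have h2 := coeff_eq_zero_of_mem_nonSquarefree h1 (d := Finsupp.single 0 1 + d) fun i ↦ by
    cases i with
    | zero => simp [d, blockExp_apply_zero]
    | succ i => simpa using blockExp_apply_le_one 0 _ (i + 1)
  rw [X, coeff_add_monomial_mul, one_mul, map_sub, coeff_tail, if_pos ⟨_, Nat.zero_le _, rfl⟩,
    MvPolynomial.coeff_coe, sub_eq_zero] at h2
  have h3 : d ∈ p.support := by rw [MvPolynomial.mem_support_iff, ← h2]; exact one_ne_zero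
  have h4 := MvPolynomial.le_totalDegree h3
  have h5 : d.degree = p.totalDegree + 1 := degree_blockExp 0 _
  rw [Finsupp.degree_apply] at h5
  exact absurd (h5.symm.trans_le h4) (by simp)

/-- The variable `X i` as an element of the example. -/
noncomputable def var (i : ℕ) : Example := ⟨toSeries (X i), Algebra.subset_adjoin (Or.inl ⟨i, rfl⟩)⟩

/-- The element `X 0 * tail n` of the example. -/
noncomputable def tailElt (n : ℕ) : Example :=
  ⟨toSeries (X 0 * tail n), Algebra.subset_adjoin (Or.inr ⟨n, rfl⟩)⟩

theorem tailElt_eq (n : ℕ) : tailElt n = var 0 + var (n + 1) * tailElt (n + 1) := by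
  apply Subtype.ext
  change toSeries (X 0 * tail n) =
    toSeries (X 0) + toSeries (X (n + 1)) * toSeries (X 0 * tail (n + 1))
  rw [tail_eq n, ← map_mul, ← map_add]
  ring_nf

/-- The partial sums of `1 + X 1 + X 1 * X 2 + ⋯`. -/
noncomputable def partialSum (n : ℕ) : Example :=
  ∑ j ∈ Finset.range n, ∏ i ∈ Finset.range j, var (i + 1)

theorem tailElt_zero_eq (n : ℕ) : tailElt 0 =
    var 0 * partialSum n + (∏ i ∈ Finset.range n, var (i + 1)) * tailElt n := by
  induction n with
  | zero => simp [partialSum]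
  | succ n ih =>
    rw [ih, partialSum, partialSum, Finset.sum_range_succ, Finset.prod_range_succ, tailElt_eq n]
    ring

theorem var_mem_maximalIdeal (i : ℕ) : var i ∈ maximalIdeal Example := by
  rw [← Ring.KrullDimLE.isNilpotent_iff_mem_maximalIdeal]
  exact ⟨2, Subtype.ext (toSeries_X_sq i)⟩

theorem prod_var_mem (n : ℕ) :
    ∏ i ∈ Finset.range n, var (i + 1) ∈ maximalIdeal Example ^ n := by
  simpa using Ideal.prod_mem_prod (s := Finset.range n) (I := fun _ ↦ maximalIdeal Example)
    fun i _ ↦ var_mem_maximalIdeal (i + 1)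

theorem tailElt_zero_notMem : tailElt 0 ∉ Ideal.span {var 0} := by
  rw [Ideal.mem_span_singleton]
  rintro ⟨z, hz⟩
  exact X_zero_mul_tail_ne z.2 (congrArg Subtype.val hz)

end SquarefreePowerSeries

open SquarefreePowerSeries in
/-- There exists a commutative local ring `R` of Krull dimension zero (every prime ideal
is maximal) with maximal ideal `m` which is separated (`⋂_{n>0} mⁿ = 0`) but not purely
separated: the canonical map `R → R̂ = lim_n R/mⁿ` is injective but not a pure
monomorphism, i.e. there is an `R`-module `M` such that the induced map
`M ≅ R ⊗_R M → R̂ ⊗_R M` is not injective. -/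
theorem stmt_14 :
    ∃ (R : Type) (_ : CommRing R) (_ : IsLocalRing R),
      (∀ p : Ideal R, p.IsPrime → p.IsMaximal) ∧
      (⨅ n : ℕ, (maximalIdeal R) ^ (n + 1)) = ⊥ ∧
      Function.Injective (AdicCompletion.of (maximalIdeal R) R) ∧
      ∃ (M : Type) (_ : AddCommGroup M) (_ : Module R M),
        ¬ Function.Injective
            (LinearMap.rTensor M (AdicCompletion.of (maximalIdeal R) R)) := by
  refine ⟨Example, inferInstance, inferInstance, fun p hp ↦ hp.isMaximal', ?_, ?_, _, _, _,
    not_injective_rTensor_adicCompletion_of (maximalIdeal Example) (a := var 0) (r := tailElt 0)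
      partialSum (fun n ↦ ?_) (fun n ↦ ?_) tailElt_zero_notMem⟩
  · refine (Submodule.eq_bot_iff _).mpr fun z hz ↦ eq_zero_of_forall_mem_maximalIdeal_pow fun n ↦ ?_
    exact Ideal.pow_le_pow_right n.le_succ (Ideal.mem_iInf.mp hz n)
  · refine AdicCompletion.of_injective_iff.mpr ⟨fun z hz ↦ ?_⟩
    refine eq_zero_of_forall_mem_maximalIdeal_pow fun n ↦ ?_
    simpa using SModEq.sub_mem.mp (hz n)
  · rw [partialSum, partialSum, Finset.sum_range_succ, sub_add_cancel_left]
    exact neg_mem (prod_var_mem n)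
  · rw [tailElt_zero_eq n, add_sub_cancel_left]
    exact Ideal.mul_mem_right _ _ (prod_var_mem n)
end
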